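/- The operator T⁽³⁾ maps 𝒪³(ℂ̄∖[0,1]) into itself, and there exists c > 0 such that for every integer r ≥ 0 and every ψ ∈ 𝒪³(ℂ̄∖[0,1]), sup_{z∈D∞} |((T⁽³⁾)^r ψ)(z)| ≤ c·((√5 − 1)/2)^r · sup_{z∈D∞} |ψ(z)|. -/

import Mathlib

open Complex Filter Set Topology
open scoped ENNReal NNReal

noncomputable section

/-- The complement in `ℂ` of the real segment `[a, b]`. -/
def cutPlane (a b : ℝ) : Set ℂ := (Complex.ofReal '' Set.Icc a b)ᶜ

/-- `𝒪¹(ℂ̄ ∖ [a,b])`: holomorphic on `ℂ ∖ [a,b]`, vanishing at infinity. -/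
def O1 (a b : ℝ) : Set (ℂ → ℂ) :=
  {φ | DifferentiableOn ℂ φ (cutPlane a b) ∧
       Tendsto φ (Bornology.cobounded ℂ) (nhds 0)}

/-- `𝒪³(ℂ̄ ∖ [a,b])`: holomorphic on `ℂ ∖ [a,b]`, with `z²ψ(z) → 0` at infinity. -/
def O3 (a b : ℝ) : Set (ℂ → ℂ) :=
  {ψ | DifferentiableOn ℂ ψ (cutPlane a b) ∧
       Tendsto (fun z => z ^ 2 * ψ z) (Bornology.cobounded ℂ) (nhds 0)}

/-- The `m`-th term (for the integer `m+1 ≥ 1`) of the series defining `T`. -/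
def Tterm (φ : ℂ → ℂ) (m : ℕ) (z : ℂ) : ℂ :=
  -z * (φ (z⁻¹ - ((m : ℂ) + 1)) - φ (-((m : ℂ) + 1))) + deriv φ (-((m : ℂ) + 1))

/-- The operator `T`. -/
def Tbrj (φ : ℂ → ℂ) : ℂ → ℂ := fun z => ∑' m : ℕ, Tterm φ m z

/-- The operator `T⁽³⁾`. -/
def T3brj (ψ : ℂ → ℂ) : ℂ → ℂ := fun z => -∑' m : ℕ, (z⁻¹) ^ 3 * ψ (z⁻¹ - ((m : ℂ) + 1))

/-- `g(m) = (0 1; 1 m)`. -/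
def gmat (m : ℤ) : Matrix (Fin 2) (Fin 2) ℤ := !![0, 1; 1, m]

/-- The monoid `ℳ`. -/
def Mmon : Set (Matrix (Fin 2) (Fin 2) ℤ) :=
  {g | g = 1 ∨
    ((g 0 0 * g 1 1 - g 0 1 * g 1 0 = 1 ∨ g 0 0 * g 1 1 - g 0 1 * g 1 0 = -1) ∧
      g 0 1 ≤ g 1 1 ∧ g 0 0 ≤ g 0 1 ∧ 0 ≤ g 0 0 ∧ g 1 0 ≤ g 1 1 ∧ g 0 0 ≤ g 1 0)}

/-- The operator `L_g` on `𝒪¹(ℂ̄ ∖ [0,1])`, for `g = (a b; c d) ∈ ℳ`. -/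
def Lop (g : Matrix (Fin 2) (Fin 2) ℤ) (φ : ℂ → ℂ) : ℂ → ℂ := fun z =>
  if g = 1 then φ z
  else
    ((g 0 0 : ℂ) - (g 1 0 : ℂ) * z) *
        (φ (((g 1 1 : ℂ) * z - (g 0 1 : ℂ)) / ((g 0 0 : ℂ) - (g 1 0 : ℂ) * z)) -
          φ (-(g 1 1 : ℂ) / (g 1 0 : ℂ))) -
      ((g 0 0 * g 1 1 - g 0 1 * g 1 0 : ℤ) : ℂ) * ((g 1 0 : ℂ))⁻¹ *
        deriv φ (-(g 1 1 : ℂ) / (g 1 0 : ℂ))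

/-- `Σ_ℳ φ`, the sum of the family `(L_g φ)_{g ∈ ℳ}`. -/
def sumM (φ : ℂ → ℂ) : ℂ → ℂ := fun z => ∑' g : Mmon, Lop g.1 φ z

/-- The domain `D`. -/
def Dset : Set ℂ :=
  {z | ‖z‖ ≤ 1 ∧ 1 ≤ ‖z - Complex.I‖ ∧ 1 ≤ ‖z + Complex.I‖ ∧ 0 < z.re}

/-- The domain `D₀`. -/
def D0set : Set ℂ := {z | ‖z + 1‖ ≤ 1 ∧ Real.sqrt 3 / 2 - 1 ≤ z.re}

/-- The domain `D₁`. -/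
def D1set : Set ℂ :=
  {z | 1 ≤ ‖z‖ ∧ ‖z - (1 / Real.sqrt 3 : ℝ)‖ ≤ 1 / Real.sqrt 3}

/-- The domain `H₀`. -/
def H0set : Set ℂ := {z | ‖z - Complex.I‖ ≤ 1 ∧ 1 ≤ ‖z + 1‖ ∧ z.im ≤ 1 / 2}

/-- The domain `H₀′`. -/
def H0set' : Set ℂ := {z | (starRingEnd ℂ) z ∈ H0set}

/-- The domain `Δ`. -/
def Δset : Set ℂ := {z | ‖z‖ ≤ 1 ∧ 1 ≤ ‖z + 1‖ ∧ |z.im| ≤ 1 / 2}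

/-- The domain `D∞`. -/
def Dinf : Set ℂ :=
  {z | 1 / 2 < |z.im|} ∪ {z | z.re < Real.sqrt 3 / 2 - 1} ∪
    {z | Real.sqrt 3 / 2 < z.re ∧ 1 / Real.sqrt 3 < ‖z - (1 / Real.sqrt 3 : ℝ)‖}

end

/-- The plane slit along `[1, ∞)`. -/
def slitFromOne : Set ℂ := (Complex.ofReal '' Set.Ici 1)ᶜ

theorem isOpen_cutPlane (a b : ℝ) : IsOpen (cutPlane a b) :=
  (isCompact_Icc.image Complex.continuous_ofReal).isClosed.isOpen_compl

theorem isOpen_slitFromOne : IsOpen slitFromOne :=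
  (Complex.isometry_ofReal.isClosedEmbedding.isClosedMap _ isClosed_Ici).isOpen_compl

theorem zero_mem_slitFromOne : (0 : ℂ) ∈ slitFromOne := by
  rintro ⟨x, hx, h⟩
  have hx' : (1 : ℝ) ≤ x := hx
  rw [Complex.ofReal_eq_zero] at h
  linarith

theorem sub_mem_cutPlane {u : ℂ} (hu : u ∈ slitFromOne) (m : ℕ) :
    u - ((m : ℂ) + 1) ∈ cutPlane 0 1 := by
  rintro ⟨x, hx, h⟩
  refine hu ⟨x + (m + 1), ?_, ?_⟩
  · have : (0 : ℝ) ≤ m := m.cast_nonneg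
    simp only [Set.mem_Ici]
    linarith [hx.1]
  · push_cast
    rw [h]
    ring

theorem ne_zero_of_mem_cutPlane {z : ℂ} (hz : z ∈ cutPlane 0 1) : z ≠ 0 := by
  rintro rfl
  exact hz ⟨0, by simp, by simp⟩

theorem inv_mem_slitFromOne {z : ℂ} (hz : z ∈ cutPlane 0 1) : z⁻¹ ∈ slitFromOne := by
  rintro ⟨x, hx, h⟩
  have hx' : (1 : ℝ) ≤ x := hx
  refine hz ⟨x⁻¹, ⟨by positivity, inv_le_one_of_one_le₀ hx'⟩, ?_⟩
  rw [Complex.ofReal_inv, h, inv_inv]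

theorem exists_norm_le_of_mem_O3 {ψ : ℂ → ℂ} (hψ : ψ ∈ O3 0 1) :
    ∃ R : ℝ, 0 < R ∧ ∀ w : ℂ, R ≤ ‖w‖ → ‖ψ w‖ ≤ (‖w‖ ^ 2)⁻¹ := by
  have h := hψ.2.eventually (Metric.closedBall_mem_nhds (0 : ℂ) one_pos)
  obtain ⟨R, -, hR⟩ := (Filter.hasBasis_cobounded_norm (E := ℂ)).eventually_iff.1 h
  refine ⟨max R 1, by positivity, fun w hw => ?_⟩
  have hw0 : 0 < ‖w‖ := lt_of_lt_of_le (by positivity) hw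
  have := hR (x := w) (by simpa using (le_max_left _ _).trans hw)
  rw [dist_zero_right, norm_mul, norm_pow] at this
  rw [← one_div, le_div_iff₀ (by positivity)]
  linarith

theorem differentiableOn_tsum_sub {ψ : ℂ → ℂ} (hψ : ψ ∈ O3 0 1) :
    DifferentiableOn ℂ (fun u => ∑' m : ℕ, ψ (u - ((m : ℂ) + 1))) slitFromOne := by
  obtain ⟨R, hR, hb⟩ := exists_norm_le_of_mem_O3 hψ
  refine SummableLocallyUniformlyOn.differentiableOn isOpen_slitFromOne
    (SummableLocallyUniformlyOn.of_locally_bounded_eventually isOpen_slitFromOne ?_) ?_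
  · intro K _ hK
    obtain ⟨B, hB⟩ := hK.isBounded.exists_norm_le
    refine ⟨fun m : ℕ => 4 * (((m + 1 : ℕ) : ℝ) ^ 2)⁻¹, ?_, ?_⟩
    · exact (((summable_nat_add_iff 1).2
        (Real.summable_nat_pow_inv.2 one_lt_two)).mul_left 4)
    · rw [Nat.cofinite_eq_atTop]
      filter_upwards [eventually_ge_atTop ⌈2 * B + 2 * R⌉₊] with m hm u hu
      have hm' : 2 * B + 2 * R ≤ m := Nat.ceil_le.1 hm
      have hu' := hB u hu
      have hu0 := norm_nonneg u
      have h1 : ((m : ℝ) + 1) - ‖u‖ ≤ ‖u - ((m : ℂ) + 1)‖ := by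
        have h2 := norm_sub_norm_le ((m : ℂ) + 1) u
        have h3 : ‖(m : ℂ) + 1‖ = (m : ℝ) + 1 := by
          exact_mod_cast Complex.norm_natCast (m + 1)
        rwa [h3, norm_sub_rev] at h2
      have h4 : ((m : ℝ) + 1) / 2 ≤ ‖u - ((m : ℂ) + 1)‖ := by linarith
      refine (hb _ (by linarith)).trans ?_
      push_cast
      calc (‖u - ((m : ℂ) + 1)‖ ^ 2)⁻¹ ≤ ((((m : ℝ) + 1) / 2) ^ 2)⁻¹ := by gcongr
        _ = 4 * (((m : ℝ) + 1) ^ 2)⁻¹ := by field_simp; norm_num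
  · intro m u hu
    have h := (hψ.1.differentiableAt ((isOpen_cutPlane 0 1).mem_nhds (sub_mem_cutPlane hu m)))
    exact DifferentiableAt.comp u h (by fun_prop)

theorem T3brj_eq (ψ : ℂ → ℂ) (z : ℂ) :
    T3brj ψ z = -((z⁻¹) ^ 3 * ∑' m : ℕ, ψ (z⁻¹ - ((m : ℂ) + 1))) := by
  rw [T3brj, tsum_mul_left]

theorem T3brj_mem_O3 {ψ : ℂ → ℂ} (hψ : ψ ∈ O3 0 1) : T3brj ψ ∈ O3 0 1 := by
  have hS := differentiableOn_tsum_sub hψ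
  have hinv : DifferentiableOn ℂ (fun z : ℂ => z⁻¹) (cutPlane 0 1) := fun z hz =>
    (differentiableAt_inv (ne_zero_of_mem_cutPlane hz)).differentiableWithinAt
  constructor
  · rw [show T3brj ψ = _ from funext (T3brj_eq ψ)]
    exact ((hinv.pow 3).mul (hS.comp hinv fun z hz => inv_mem_slitFromOne hz)).neg
  · have hc := (hS.differentiableAt
      (isOpen_slitFromOne.mem_nhds zero_mem_slitFromOne)).continuousAt
    have hi : Tendsto (fun z : ℂ => z⁻¹) (Bornology.cobounded ℂ) (𝓝 0) :=
      tendsto_inv₀_cobounded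
    have h := (hi.mul (hc.tendsto.comp hi)).neg
    rw [zero_mul, neg_zero] at h
    refine h.congr' ?_
    filter_upwards [hasBasis_cobounded_norm.mem_of_mem (i := (1 : ℝ)) trivial] with z hz
    have hz0 : z ≠ 0 := by
      rintro rfl
      norm_num at hz
    rw [T3brj_eq, Function.comp_apply]
    field_simp

theorem mem_Dinf_of_two_lt_norm {z : ℂ} (hz : 2 < ‖z‖) : z ∈ Dinf := by
  by_contra h
  simp only [Dinf, Set.mem_union, Set.mem_ofPred_eq, not_or, not_and, not_lt] at h
  obtain ⟨⟨h1, h2⟩, h3⟩ := h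
  have hs : Real.sqrt 3 ^ 2 = 3 := Real.sq_sqrt (by norm_num)
  have hs1 : 1.7 ≤ Real.sqrt 3 := Real.le_sqrt_of_sq_le (by norm_num)
  have hs2 : Real.sqrt 3 ≤ 1.8 := Real.sqrt_le_iff.2 (by norm_num)
  have hr : z.re ≤ 1.5 := by
    by_contra! hr
    have h4 := (Complex.re_le_norm (z - (1 / Real.sqrt 3 : ℝ))).trans (h3 (by linarith))
    rw [Complex.sub_re, Complex.ofReal_re] at h4
    have : 1 / Real.sqrt 3 ≤ 0.6 := by
      rw [div_le_iff₀ (by linarith)]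
      linarith
    linarith
  have h5 := Complex.norm_le_abs_re_add_abs_im z
  have h6 : |z.re| ≤ 1.5 := abs_le.2 ⟨by linarith, hr⟩
  linarith

theorem inv_sub_mem_Dinf {z : ℂ} (hz : z ∈ Dinf) (m : ℕ) : z⁻¹ - ((m : ℂ) + 1) ∈ Dinf := by
  by_contra h
  simp only [Dinf, Set.mem_union, Set.mem_ofPred_eq, not_or, not_and, not_lt] at h
  obtain ⟨⟨h1, h2⟩, -⟩ := h
  have hs : Real.sqrt 3 ^ 2 = 3 := Real.sq_sqrt (by norm_num)
  have hs0 : 0 < Real.sqrt 3 := by positivity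
  have hs2 : Real.sqrt 3 ≤ 1.8 := Real.sqrt_le_iff.2 (by norm_num)
  have hm : (0 : ℝ) ≤ m := m.cast_nonneg
  obtain ⟨v, rfl⟩ : ∃ v : ℂ, z = v⁻¹ := ⟨z⁻¹, (inv_inv z).symm⟩
  rw [inv_inv] at h1 h2
  simp only [Complex.sub_im, Complex.add_im, Complex.natCast_im, Complex.one_im, add_zero,
    sub_zero] at h1
  simp only [Complex.sub_re, Complex.add_re, Complex.natCast_re, Complex.one_re] at h2
  have hre : Real.sqrt 3 / 2 ≤ v.re := by linarith
  have hN : 0 < Complex.normSq v := by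
    rw [Complex.normSq_apply]
    nlinarith [mul_self_nonneg v.im]
  rcases hz with (hz | hz) | hz
  · simp only [Set.mem_ofPred_eq, Complex.inv_im, abs_div, abs_neg, abs_of_pos hN] at hz
    rw [lt_div_iff₀ hN, Complex.normSq_apply] at hz
    have := abs_mul_abs_self v.im
    nlinarith
  · simp only [Set.mem_ofPred_eq, Complex.inv_re] at hz
    have : 0 ≤ v.re / Complex.normSq v := by
      apply div_nonneg _ hN.le
      linarith
    linarith
  · obtain ⟨-, hz⟩ := hz
    refine absurd hz (not_lt.2 ?_)
    rw [← abs_of_pos (show 0 < 1 / Real.sqrt 3 by positivity), ← Real.norm_eq_abs]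
    rw [Complex.norm_def, Real.norm_eq_abs]
    apply Real.sqrt_le_iff.2
    refine ⟨abs_nonneg _, ?_⟩
    rw [sq_abs, Complex.normSq_apply]
    simp only [Complex.sub_re, Complex.sub_im, Complex.ofReal_re, Complex.ofReal_im,
      Complex.inv_re, Complex.inv_im, abs_of_pos (show 0 < 1 / Real.sqrt 3 by positivity)]
    have key : (v.re / normSq v) ^ 2 + (v.im / normSq v) ^ 2 = 1 / normSq v := by
      rw [div_pow, div_pow, ← add_div, div_eq_div_iff (by positivity) hN.ne']
      rw [Complex.normSq_apply]
      ring
    have key2 : 1 / normSq v ≤ 2 * (v.re / normSq v) * (1 / Real.sqrt 3) := by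
      rw [mul_one_div, le_div_iff₀ hs0, one_div_mul_eq_div, mul_div_assoc']
      gcongr
      linarith
    have e : -v.im / normSq v = -(v.im / normSq v) := neg_div _ _
    rw [e]
    nlinarith

theorem le_norm_sub_of_mem_Dinf {z : ℂ} (hz : z ∈ Dinf) {t : ℝ} (ht : t ∈ Set.Icc (0 : ℝ) 1) :
    1 / 10 ≤ ‖z - t‖ := by
  have hs : Real.sqrt 3 ^ 2 = 3 := Real.sq_sqrt (by norm_num)
  have hs1 : 1.73 ≤ Real.sqrt 3 := Real.le_sqrt_of_sq_le (by norm_num)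
  have hs2 : Real.sqrt 3 ≤ 1.74 := Real.sqrt_le_iff.2 (by norm_num)
  have hre := Complex.abs_re_le_norm (z - t)
  have him := Complex.abs_im_le_norm (z - t)
  simp only [Complex.sub_re, Complex.sub_im, Complex.ofReal_re, Complex.ofReal_im,
    sub_zero] at hre him
  obtain ⟨ht0, ht1⟩ := ht
  rcases hz with (hz | hz) | ⟨hz, hz'⟩
  · have : 1 / 2 < |z.im| := hz
    linarith
  · have : z.re < Real.sqrt 3 / 2 - 1 := hz
    linarith [neg_abs_le (z.re - t)]
  · rcases le_total t (1 / 2) with h | h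
    · linarith [le_abs_self (z.re - t)]
    · have h1 : 1 / Real.sqrt 3 ≤ 0.6 := by
        rw [div_le_iff₀ (by linarith)]
        linarith
      have h2 : 0.57 ≤ 1 / Real.sqrt 3 := by
        rw [le_div_iff₀ (by linarith)]
        linarith
      have h3 : ‖(t : ℂ) - (1 / Real.sqrt 3 : ℝ)‖ ≤ 0.43 := by
        rw [← Complex.ofReal_sub, Complex.norm_real, Real.norm_eq_abs]
        exact abs_le.2 ⟨by linarith, by linarith⟩
      have h4 := norm_add_le (z - t) ((t : ℂ) - (1 / Real.sqrt 3 : ℝ))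
      rw [sub_add_sub_cancel] at h4
      linarith

theorem mem_cutPlane_of_mem_Dinf {z : ℂ} (hz : z ∈ Dinf) : z ∈ cutPlane 0 1 := by
  rintro ⟨t, ht, rfl⟩
  have := le_norm_sub_of_mem_Dinf hz ht
  norm_num at this

/-- The density `(Φ + t) / |z - t|³` with `Φ = (√5 + 1) / 2`. -/
noncomputable def cubicDensity (z : ℂ) (t : ℝ) : ℝ := ((Real.sqrt 5 + 1) / 2 + t) / ‖z - t‖ ^ 3

/-- The weight `∫₀¹ (Φ + t) / |z - t|³ dt`, a supersolution of the transfer operator with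
branches `z ↦ z⁻¹ - m` and cubic cocycle. -/
noncomputable def cubicWeight (z : ℂ) : ℝ := ∫ t in (0 : ℝ)..1, cubicDensity z t

theorem cubicDensity_nonneg (z : ℂ) {t : ℝ} (ht : 0 ≤ t) : 0 ≤ cubicDensity z t := by
  unfold cubicDensity
  positivity

theorem sub_ofReal_ne_zero {z : ℂ} (hz : z ∈ cutPlane 0 1) {t : ℝ} (ht : t ∈ Set.Icc (0 : ℝ) 1) :
    z - t ≠ 0 := fun h => hz ⟨t, ht, (sub_eq_zero.1 h).symm⟩

theorem continuousOn_cubicDensity {z : ℂ} (hz : z ∈ cutPlane 0 1) :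
    ContinuousOn (cubicDensity z) (Set.Icc 0 1) := by
  unfold cubicDensity
  refine ContinuousOn.div (by fun_prop) (by fun_prop) fun t ht => ?_
  exact pow_ne_zero _ (norm_ne_zero_iff.2 (sub_ofReal_ne_zero hz ht))

theorem intervalIntegrable_cubicDensity {z : ℂ} (hz : z ∈ cutPlane 0 1) {a b : ℝ}
    (ha : a ∈ Set.Icc (0 : ℝ) 1) (hb : b ∈ Set.Icc (0 : ℝ) 1) :
    IntervalIntegrable (cubicDensity z) MeasureTheory.volume a b :=
  ((continuousOn_cubicDensity hz).mono
    (Set.ordConnected_Icc.uIcc_subset ha hb)).intervalIntegrable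

theorem cubicWeight_nonneg (z : ℂ) : 0 ≤ cubicWeight z :=
  intervalIntegral.integral_nonneg zero_le_one fun _ ht => cubicDensity_nonneg z ht.1

theorem inv_le_cubicWeight {z : ℂ} (hz : z ∈ cutPlane 0 1) :
    ((1 + ‖z‖) ^ 3)⁻¹ ≤ cubicWeight z := by
  have h : ∫ _ in (0 : ℝ)..1, ((1 + ‖z‖) ^ 3)⁻¹ ≤ cubicWeight z := by
    refine intervalIntegral.integral_mono_on zero_le_one intervalIntegrable_const
      (intervalIntegrable_cubicDensity hz (by simp) (by simp)) fun t ht => ?_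
    have h5 : 1 ≤ Real.sqrt 5 := Real.one_le_sqrt.2 (by norm_num)
    have h1 : 0 < ‖z - t‖ := norm_pos_iff.2 (sub_ofReal_ne_zero hz ht)
    have h2 : ‖z - t‖ ≤ 1 + ‖z‖ := by
      have := norm_sub_le z t
      rw [Complex.norm_real, Real.norm_eq_abs, abs_of_nonneg ht.1] at this
      linarith [ht.2]
    rw [← one_div, cubicDensity]
    have h3 := ht.1
    gcongr
    linarith
  simpa using h

theorem cubicWeight_le_of_mem_Dinf {z : ℂ} (hz : z ∈ Dinf) : cubicWeight z ≤ 3000 := by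
  have h : cubicWeight z ≤ ∫ _ in (0 : ℝ)..1, 3000 := by
    refine intervalIntegral.integral_mono_on zero_le_one
      (intervalIntegrable_cubicDensity (mem_cutPlane_of_mem_Dinf hz) (by simp) (by simp))
      intervalIntegrable_const fun t ht => ?_
    have h5 : Real.sqrt 5 ≤ 3 := Real.sqrt_le_iff.2 (by norm_num)
    have h1 := le_norm_sub_of_mem_Dinf hz ht
    have h2 : (1 / 10 : ℝ) ^ 3 ≤ ‖z - t‖ ^ 3 := by gcongr
    rw [cubicDensity, div_le_iff₀ (by linarith)]
    linarith [ht.2]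
  simpa using h

theorem cubicDensity_inv_sub_le {z : ℂ} (hz : z ∈ cutPlane 0 1) (m : ℕ) {t : ℝ}
    (ht : t ∈ Set.Icc (0 : ℝ) 1) :
    ‖z⁻¹‖ ^ 3 * cubicDensity (z⁻¹ - ((m : ℂ) + 1)) t ≤
      (Real.sqrt 5 - 1) / 2 *
        (cubicDensity z ((m + 1 + t)⁻¹) * ((((m : ℝ) + 1 + t) ^ 2)⁻¹)) := by
  have hz0 := ne_zero_of_mem_cutPlane hz
  have hs : Real.sqrt 5 ^ 2 = 5 := Real.sq_sqrt (by norm_num)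
  have hm : (0 : ℝ) ≤ m := m.cast_nonneg
  obtain ⟨y, hy⟩ : ∃ y : ℝ, y = m + 1 + t := ⟨_, rfl⟩
  have hy0 : 0 < y := by linarith [ht.1]
  have hw : z⁻¹ - ((m : ℂ) + 1) - t = z⁻¹ - y := by
    rw [hy]
    push_cast
    ring
  have hyC : (y : ℂ) ≠ 0 := by exact_mod_cast hy0.ne'
  have hfac : z - ((y⁻¹ : ℝ) : ℂ) = -(z * (y : ℂ)⁻¹ * (z⁻¹ - y)) := by
    push_cast
    field_simp
    ring
  have hn : 0 < ‖z⁻¹ - y‖ := by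
    rw [← hw]
    exact norm_pos_iff.2 (sub_ofReal_ne_zero (sub_mem_cutPlane (inv_mem_slitFromOne hz) m) ht)
  have hzn : 0 < ‖z‖ := norm_pos_iff.2 hz0
  unfold cubicDensity
  rw [hw, ← hy, hfac, norm_neg, norm_mul, norm_mul, norm_inv, norm_inv, Complex.norm_real,
    Real.norm_eq_abs, abs_of_pos hy0]
  have hle : (Real.sqrt 5 + 1) / 2 + t ≤ y + (Real.sqrt 5 - 1) / 2 := by
    rw [hy]
    linarith
  generalize ‖z⁻¹ - y‖ = q at hn ⊢
  calc ‖z‖⁻¹ ^ 3 * (((Real.sqrt 5 + 1) / 2 + t) / q ^ 3)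
      ≤ ‖z‖⁻¹ ^ 3 * ((y + (Real.sqrt 5 - 1) / 2) / q ^ 3) := by gcongr
    _ = _ := by
      field_simp
      linear_combination (-y) * hs

theorem inv_mem_Icc {y : ℝ} (hy : 1 ≤ y) : y⁻¹ ∈ Set.Icc (0 : ℝ) 1 :=
  ⟨by positivity, inv_le_one_of_one_le₀ hy⟩

theorem cubicWeight_inv_sub_le {z : ℂ} (hz : z ∈ cutPlane 0 1) (m : ℕ) :
    ‖z⁻¹‖ ^ 3 * cubicWeight (z⁻¹ - ((m : ℂ) + 1)) ≤
      (Real.sqrt 5 - 1) / 2 *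
        ∫ x in ((m : ℝ) + 1 + 1)⁻¹..((m : ℝ) + 1)⁻¹, cubicDensity z x := by
  have hm : (0 : ℝ) ≤ m := m.cast_nonneg
  have hsub : Set.uIcc (0 : ℝ) 1 = Set.Icc 0 1 := Set.uIcc_of_le zero_le_one
  have hmaps : ∀ t ∈ Set.Icc (0 : ℝ) 1, ((m : ℝ) + 1 + t)⁻¹ ∈ Set.Icc (0 : ℝ) 1 :=
    fun t ht => inv_mem_Icc (by linarith [ht.1])
  have hderiv : ∀ t ∈ Set.uIcc (0 : ℝ) 1,
      HasDerivAt (fun t : ℝ => ((m : ℝ) + 1 + t)⁻¹) (-(((m : ℝ) + 1 + t) ^ 2)⁻¹) t := by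
    intro t ht
    rw [hsub] at ht
    have h := ((hasDerivAt_id t).const_add ((m : ℝ) + 1)).inv
      (by have := ht.1; simp only [id]; positivity)
    simpa [neg_div, Pi.inv_def] using h
  have hcont : ContinuousOn (fun t : ℝ => (((m : ℝ) + 1 + t) ^ 2)⁻¹) (Set.Icc 0 1) :=
    ContinuousOn.inv₀ (by fun_prop) fun t ht => by have := ht.1; positivity
  have hcov := intervalIntegral.integral_comp_mul_deriv' (g := cubicDensity z) hderiv
    (by rw [hsub]; exact hcont.neg)
    ((continuousOn_cubicDensity hz).mono (by
      rw [hsub]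
      rintro _ ⟨t, ht, rfl⟩
      exact hmaps t ht))
  have hcov' : ∫ t in (0 : ℝ)..1,
      cubicDensity z ((m + 1 + t)⁻¹) * ((((m : ℝ) + 1 + t) ^ 2)⁻¹) =
        ∫ x in ((m : ℝ) + 1 + 1)⁻¹..((m : ℝ) + 1)⁻¹, cubicDensity z x := by
    simp only [Function.comp_def, mul_neg, intervalIntegral.integral_neg, add_zero] at hcov
    rw [intervalIntegral.integral_symm ((m : ℝ) + 1)⁻¹, ← hcov, neg_neg]
  rw [← hcov', cubicWeight, ← intervalIntegral.integral_const_mul,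
    ← intervalIntegral.integral_const_mul]
  refine intervalIntegral.integral_mono_on zero_le_one
    ((intervalIntegrable_cubicDensity (sub_mem_cutPlane (inv_mem_slitFromOne hz) m)
      (by simp) (by simp)).const_mul _) ?_ fun t ht => cubicDensity_inv_sub_le hz m ht
  refine (ContinuousOn.intervalIntegrable ?_).const_mul _
  rw [hsub]
  refine ContinuousOn.mul ?_ hcont
  refine (continuousOn_cubicDensity hz).comp ?_ hmaps
  exact ContinuousOn.inv₀ (by fun_prop) fun t ht => by have := ht.1; positivity

theorem sum_cubicWeight_inv_sub_le {z : ℂ} (hz : z ∈ cutPlane 0 1) (n : ℕ) :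
    ∑ m ∈ Finset.range n, ‖z⁻¹‖ ^ 3 * cubicWeight (z⁻¹ - ((m : ℂ) + 1)) ≤
      (Real.sqrt 5 - 1) / 2 * cubicWeight z := by
  have hg : 0 ≤ (Real.sqrt 5 - 1) / 2 := by
    linarith [Real.one_le_sqrt.2 (show (1 : ℝ) ≤ 5 by norm_num)]
  have hmem : ∀ m : ℕ, ((m : ℝ) + 1)⁻¹ ∈ Set.Icc (0 : ℝ) 1 := fun m =>
    inv_mem_Icc (by linarith [show (0 : ℝ) ≤ m from m.cast_nonneg])
  refine (Finset.sum_le_sum fun m _ => cubicWeight_inv_sub_le hz m).trans ?_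
  rw [← Finset.mul_sum]
  refine mul_le_mul_of_nonneg_left ?_ hg
  have hadj := intervalIntegral.sum_integral_adjacent_intervals (f := cubicDensity z)
    (μ := MeasureTheory.volume) (a := fun m : ℕ => ((m : ℝ) + 1)⁻¹) (n := n)
    fun k _ => intervalIntegrable_cubicDensity hz (hmem k) (hmem (k + 1))
  have hsum : ∑ m ∈ Finset.range n,
      ∫ x in ((m : ℝ) + 1 + 1)⁻¹..((m : ℝ) + 1)⁻¹, cubicDensity z x =
        ∫ x in ((n : ℝ) + 1)⁻¹..1, cubicDensity z x := by
    rw [intervalIntegral.integral_symm, ← neg_inj, neg_neg, ← Finset.sum_neg_distrib]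
    simpa [← intervalIntegral.integral_symm] using hadj
  have hsplit := intervalIntegral.integral_add_adjacent_intervals
    (intervalIntegrable_cubicDensity hz (a := 0) (by simp) (hmem n))
    (intervalIntegrable_cubicDensity hz (b := 1) (hmem n) (by simp))
  have hnn : 0 ≤ ∫ x in (0 : ℝ)..((n : ℝ) + 1)⁻¹, cubicDensity z x :=
    intervalIntegral.integral_nonneg (hmem n).1 fun _ ht => cubicDensity_nonneg z ht.1
  rw [hsum, cubicWeight]
  linarith

theorem norm_T3brj_le {ψ : ℂ → ℂ} {A : ℝ} (hA : 0 ≤ A)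
    (h : ∀ z ∈ Dinf, ‖ψ z‖ ≤ A * cubicWeight z) {z : ℂ} (hz : z ∈ Dinf) :
    ‖T3brj ψ z‖ ≤ A * ((Real.sqrt 5 - 1) / 2) * cubicWeight z := by
  have hz' := mem_cutPlane_of_mem_Dinf hz
  have hnn : ∀ m : ℕ, 0 ≤ ‖z⁻¹‖ ^ 3 * cubicWeight (z⁻¹ - ((m : ℂ) + 1)) := fun m =>
    mul_nonneg (by positivity) (cubicWeight_nonneg _)
  have hsum := summable_of_sum_range_le hnn (sum_cubicWeight_inv_sub_le hz')
  have htsum := Real.tsum_le_of_sum_range_le hnn (sum_cubicWeight_inv_sub_le hz')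
  rw [T3brj, norm_neg, mul_assoc]
  refine (tsum_of_norm_bounded (hsum.hasSum.mul_left A) fun m => ?_).trans
    (mul_le_mul_of_nonneg_left htsum hA)
  rw [norm_mul, norm_pow, mul_left_comm]
  exact mul_le_mul_of_nonneg_left (h _ (inv_sub_mem_Dinf hz m)) (by positivity)

theorem norm_iterate_T3brj_le {ψ : ℂ → ℂ} {A : ℝ} (hA : 0 ≤ A)
    (h : ∀ z ∈ Dinf, ‖ψ z‖ ≤ A * cubicWeight z) (r : ℕ) :
    ∀ z ∈ Dinf, ‖(T3brj^[r] ψ) z‖ ≤ A * ((Real.sqrt 5 - 1) / 2) ^ r * cubicWeight z := by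
  have hg : 0 ≤ (Real.sqrt 5 - 1) / 2 := by
    linarith [Real.one_le_sqrt.2 (show (1 : ℝ) ≤ 5 by norm_num)]
  induction r with
  | zero => simpa using h
  | succ r ih =>
    intro z hz
    rw [Function.iterate_succ_apply', pow_succ, ← mul_assoc]
    exact norm_T3brj_le (by positivity) ih hz

theorem norm_le_of_two_lt_norm {ψ : ℂ → ℂ} (hψ : ψ ∈ O3 0 1) {M : ℝ}
    (hM : ∀ z ∈ Dinf, ‖ψ z‖ ≤ M) {z : ℂ} (hz : 2 < ‖z‖) : ‖ψ z‖ ≤ M * (2 / ‖z‖) ^ 3 := by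
  obtain ⟨f, hf⟩ : ∃ f : ℂ → ℂ, f = Function.update (fun u => ψ u⁻¹) 0 0 := ⟨_, rfl⟩
  have hf0 : f 0 = 0 := by simp [hf]
  have hfne : ∀ u ≠ 0, f u = ψ u⁻¹ := fun u hu => by simp [hf, hu]
  have hlarge : ∀ u ∈ Metric.ball (0 : ℂ) (1 / 2), u ≠ 0 → 2 < ‖u⁻¹‖ := by
    intro u hu hu0
    rw [mem_ball_zero_iff] at hu
    rw [norm_inv, lt_inv_comm₀ two_pos (norm_pos_iff.2 hu0)]
    linarith
  have hlim : Tendsto (fun u : ℂ => (u⁻¹) ^ 2 * ψ u⁻¹) (𝓝[≠] 0) (𝓝 0) :=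
    hψ.2.comp tendsto_inv₀_nhdsNE_zero
  have hlittle : f =o[𝓝 0] fun u : ℂ => u ^ 2 := by
    rw [← nhdsNE_sup_pure, Asymptotics.isLittleO_sup]
    refine ⟨?_, Asymptotics.isLittleO_pure.2 hf0⟩
    have hO : (fun u : ℂ => u ^ 2 * ((u⁻¹) ^ 2 * ψ u⁻¹)) =o[𝓝[≠] 0] fun u : ℂ => u ^ 2 * 1 :=
      (Asymptotics.isBigO_refl _ _).mul_isLittleO ((Asymptotics.isLittleO_one_iff ℂ).2 hlim)
    refine hO.congr' ?_ (by simp)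
    filter_upwards [self_mem_nhdsWithin] with u hu
    have hu0 : u ≠ 0 := hu
    rw [hfne u hu0]
    field_simp
  have hM0 : 0 ≤ M := (norm_nonneg _).trans (hM z (mem_Dinf_of_two_lt_norm hz))
  have hcont : ContinuousAt f 0 := by
    have h2 : Tendsto (fun u : ℂ => u ^ 2) (𝓝 0) (𝓝 0) := by
      simpa using (continuous_pow 2).tendsto (0 : ℂ)
    rw [ContinuousAt, hf0]
    exact hlittle.trans_tendsto h2
  have hdiff : DifferentiableOn ℂ f (Metric.ball 0 (1 / 2)) := by
    rw [← Complex.differentiableOn_compl_singleton_and_continuousAt_iff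
      (Metric.ball_mem_nhds (0 : ℂ) (by norm_num : (0 : ℝ) < 1 / 2))]
    refine ⟨DifferentiableOn.congr (f := fun u => ψ u⁻¹) ?_ fun u hu => hfne u hu.2, hcont⟩
    rintro u ⟨hu, hu0⟩
    have h := hψ.1.differentiableAt ((isOpen_cutPlane 0 1).mem_nhds
      (mem_cutPlane_of_mem_Dinf (mem_Dinf_of_two_lt_norm (hlarge u hu hu0))))
    exact (DifferentiableAt.comp u h (differentiableAt_inv hu0)).differentiableWithinAt
  have hmaps : Set.MapsTo f (Metric.ball 0 (1 / 2)) (Metric.closedBall (f 0) M) := by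
    intro u hu
    rw [hf0, mem_closedBall_zero_iff]
    by_cases hu0 : u = 0
    · simpa [hu0, hf0] using hM0
    · rw [hfne u hu0]
      exact hM _ (mem_Dinf_of_two_lt_norm (hlarge u hu hu0))
  have hz0 : z ≠ 0 := norm_pos_iff.1 (two_pos.trans hz)
  have hzb : z⁻¹ ∈ Metric.ball (0 : ℂ) (1 / 2) := by
    rw [mem_ball_zero_iff, norm_inv, one_div]
    exact inv_strictAnti₀ two_pos hz
  have h := Complex.dist_le_mul_div_pow_of_mapsTo_ball_of_isLittleO (n := 2) hdiff hmaps
    (by simpa [hf0] using hlittle.norm_right) hzb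
  rw [hf0, dist_zero_right, dist_zero_right, hfne _ (inv_ne_zero hz0), inv_inv, norm_inv] at h
  convert h using 3
  field_simp

theorem norm_le_mul_cubicWeight {ψ : ℂ → ℂ} (hψ : ψ ∈ O3 0 1) {M : ℝ}
    (hM : ∀ z ∈ Dinf, ‖ψ z‖ ≤ M) {z : ℂ} (hz : z ∈ Dinf) :
    ‖ψ z‖ ≤ 27 * M * cubicWeight z := by
  have hM0 : 0 ≤ M := (norm_nonneg _).trans (hM z hz)
  have h0 := norm_nonneg z
  suffices h : ‖ψ z‖ ≤ 27 * M * ((1 + ‖z‖) ^ 3)⁻¹ from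
    h.trans (mul_le_mul_of_nonneg_left (inv_le_cubicWeight (mem_cutPlane_of_mem_Dinf hz))
      (by positivity))
  rcases le_or_gt ‖z‖ 2 with h | h
  · refine (hM z hz).trans ?_
    rw [← div_eq_mul_inv, le_div_iff₀ (by positivity), mul_comm 27 M]
    refine mul_le_mul_of_nonneg_left ?_ hM0
    calc (1 + ‖z‖) ^ 3 ≤ (1 + 2) ^ 3 := by gcongr
      _ = 27 := by norm_num
  · refine (norm_le_of_two_lt_norm hψ hM h).trans ?_
    rw [mul_comm 27 M, mul_assoc]
    refine mul_le_mul_of_nonneg_left ?_ hM0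
    have h1 : 2 / ‖z‖ ≤ 3 / (1 + ‖z‖) := by
      rw [div_le_div_iff₀ (by linarith) (by linarith)]
      linarith
    calc (2 / ‖z‖) ^ 3 ≤ (3 / (1 + ‖z‖)) ^ 3 := by gcongr
      _ = 27 * ((1 + ‖z‖) ^ 3)⁻¹ := by rw [div_pow, div_eq_mul_inv]; norm_num

/-- `T⁽³⁾` maps `𝒪³(ℂ̄∖[0,1])` into itself and its iterates contract
on `D∞` with rate `(√5 − 1)/2`. -/
theorem T3_spectral_estimate_on_Dinf :
    (∀ ψ ∈ O3 0 1, T3brj ψ ∈ O3 0 1) ∧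
      ∃ c > 0, ∀ (r : ℕ), ∀ ψ ∈ O3 0 1, ∀ M : ℝ,
        (∀ z ∈ Dinf, ‖ψ z‖ ≤ M) →
          ∀ z ∈ Dinf, ‖(T3brj^[r] ψ) z‖ ≤ c * ((Real.sqrt 5 - 1) / 2) ^ r * M := by
  refine ⟨fun ψ hψ => T3brj_mem_O3 hψ, 81000, by norm_num, fun r ψ hψ M hM z hz => ?_⟩
  have hM0 : 0 ≤ M := (norm_nonneg _).trans (hM z hz)
  have hg : 0 ≤ (Real.sqrt 5 - 1) / 2 := by
    linarith [Real.one_le_sqrt.2 (show (1 : ℝ) ≤ 5 by norm_num)]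
  calc ‖(T3brj^[r] ψ) z‖
      ≤ 27 * M * ((Real.sqrt 5 - 1) / 2) ^ r * cubicWeight z :=
        norm_iterate_T3brj_le (by positivity)
          (fun w hw => norm_le_mul_cubicWeight hψ hM hw) r z hz
    _ ≤ 27 * M * ((Real.sqrt 5 - 1) / 2) ^ r * 3000 := by
        gcongr
        exact cubicWeight_le_of_mem_Dinf hz
    _ = 81000 * ((Real.sqrt 5 - 1) / 2) ^ r * M := by ring
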